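/- Fix an integer g ≥ 0 and a sequence (k_n) of nonnegative integers with k_n/√n → 0 as n → ∞. For n ≥ 2, let F be a uniformly random element of 𝔽ₙᵍ and let f_{k_n} denote its prefix consisting of its first min(k_n, n−1+2g) transpositions. Then the probability that G(f_{k_n}) = 0 — i.e. that the prefix is also the prefix of some minimal factorization of the n-cycle — tends to 1 as n → ∞. -/

import Mathlib

open Filter

/-- Left-to-right product of a list of permutations: the leftmost entry is applied first. -/
def prodLR {n : ℕ} (l : List (Equiv.Perm (Fin n))) : Equiv.Perm (Fin n) :=
  l.reverse.prod

/-- The set `𝔽ₙᵍ` of genus-`g` factorizations of the `n`-cycle `(1 2 ⋯ n)`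
into transpositions. -/
def Fcal (n g : ℕ) : Set (List (Equiv.Perm (Fin n))) :=
  {l | l.length = n - 1 + 2 * g ∧ (∀ t ∈ l, t.IsSwap) ∧ prodLR l = finRotate n}

/-- The genus of a partial factorization: the least `g` such that it extends to an
element of `𝔽ₙᵍ`. -/
noncomputable def genus (n : ℕ) (f : List (Equiv.Perm (Fin n))) : ℕ :=
  sInf {g | ∃ l, f <+: l ∧ l ∈ Fcal n g}

open Equiv.Perm in
noncomputable def cyc {n : ℕ} (u : Equiv.Perm (Fin n)) : ℕ :=
  Nat.card (Quotient (SameCycle.setoid u))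

section perms
open Equiv.Perm
variable {n : ℕ}

lemma sameCycle_of_step {u : Equiv.Perm (Fin n)} {R : Fin n → Fin n → Prop}
    (hR : Equivalence R) (h : ∀ x, R x (u x)) {x y : Fin n} (hxy : SameCycle u x y) : R x y := by
  obtain ⟨i, rfl⟩ := hxy.exists_nat_pow_eq
  clear hxy
  induction i with
  | zero => exact hR.refl _
  | succ i ih =>
    rw [pow_succ', Equiv.Perm.mul_apply]
    exact hR.trans ih (h _)

lemma sameCycle_le {u w : Equiv.Perm (Fin n)} (h : ∀ x, SameCycle w x (u x)) {x y : Fin n}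
    (hxy : SameCycle u x y) : SameCycle w x y :=
  sameCycle_of_step (SameCycle.equivalence w) h hxy

lemma merge_same {u : Equiv.Perm (Fin n)} {a b : Fin n} (h : ¬ SameCycle u a b) :
    SameCycle (Equiv.swap a b * u) a b := by
  classical
  have hex : ∃ d, 0 < d ∧ (u ^ d) a = a := ⟨orderOf u, orderOf_pos u, by simp [pow_orderOf_eq_one]⟩
  obtain ⟨hd0, hd⟩ := Nat.find_spec hex
  have hmin : ∀ i, 0 < i → i < Nat.find hex → (u ^ i) a ≠ a := fun i h0 hi h' =>
    Nat.find_min hex hi ⟨h0, h'⟩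
  set d := Nat.find hex with hdd
  have key : ∀ i, i < d → ((Equiv.swap a b * u) ^ i) a = (u ^ i) a := by
    intro i
    induction i with
    | zero => simp
    | succ i ih =>
      intro hi
      rw [pow_succ', Equiv.Perm.mul_apply, ih (by omega), pow_succ', Equiv.Perm.mul_apply,
        Equiv.Perm.mul_apply]
      apply Equiv.swap_apply_of_ne_of_ne
      · have := hmin (i+1) (by omega) hi
        rwa [pow_succ', Equiv.Perm.mul_apply] at this
      · intro h'
        apply h
        refine ⟨(i+1 : ℕ), ?_⟩
        rw [zpow_natCast, pow_succ', Equiv.Perm.mul_apply, h']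
  refine ⟨(d : ℕ), ?_⟩
  obtain ⟨e, he⟩ : ∃ e, d = e + 1 := ⟨d - 1, by omega⟩
  rw [zpow_natCast, he, pow_succ', Equiv.Perm.mul_apply, key e (by omega), Equiv.Perm.mul_apply]
  rw [he, pow_succ', Equiv.Perm.mul_apply] at hd
  rw [hd, Equiv.swap_apply_left]

lemma merge_mono {u : Equiv.Perm (Fin n)} {a b : Fin n} (hs : SameCycle (Equiv.swap a b * u) a b)
    {x y : Fin n} (hxy : SameCycle u x y) : SameCycle (Equiv.swap a b * u) x y := by
  refine sameCycle_le (fun x => ?_) hxy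
  have h1 : SameCycle (Equiv.swap a b * u) x ((Equiv.swap a b * u) x) :=
    sameCycle_apply_right.2 SameCycle.rfl
  rw [Equiv.Perm.mul_apply] at h1
  by_cases ha : u x = a
  · rw [ha, Equiv.swap_apply_left] at h1
    rw [ha]; exact h1.trans hs.symm
  by_cases hb : u x = b
  · rw [hb, Equiv.swap_apply_right] at h1
    rw [hb]; exact h1.trans hs
  rwa [Equiv.swap_apply_of_ne_of_ne ha hb] at h1

lemma merge_conv {u : Equiv.Perm (Fin n)} {a b : Fin n}
    {x y : Fin n} (hxy : SameCycle (Equiv.swap a b * u) x y) :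
    SameCycle u x y ∨ ((SameCycle u x a ∨ SameCycle u x b) ∧ (SameCycle u y a ∨ SameCycle u y b)) := by
  refine sameCycle_of_step (R := fun x y => SameCycle u x y ∨
    ((SameCycle u x a ∨ SameCycle u x b) ∧ (SameCycle u y a ∨ SameCycle u y b))) ?_ ?_ hxy
  · refine ⟨fun x => Or.inl SameCycle.rfl, ?_, ?_⟩
    · rintro x y (h | ⟨h1, h2⟩)
      · exact Or.inl h.symm
      · exact Or.inr ⟨h2, h1⟩
    · rintro x y z (h | ⟨h1, h2⟩) (h' | ⟨h1', h2'⟩)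
      · exact Or.inl (h.trans h')
      · exact Or.inr ⟨h1'.imp h.trans h.trans, h2'⟩
      · exact Or.inr ⟨h1, h2.imp h'.symm.trans h'.symm.trans⟩
      · exact Or.inr ⟨h1, h2'⟩
  · intro x
    rw [Equiv.Perm.mul_apply]
    have h1 : SameCycle u x (u x) := sameCycle_apply_right.2 SameCycle.rfl
    by_cases ha : u x = a
    · rw [ha] at h1 ⊢
      rw [Equiv.swap_apply_left]
      exact Or.inr ⟨Or.inl h1, Or.inr SameCycle.rfl⟩
    by_cases hb : u x = b
    · rw [hb] at h1 ⊢
      rw [Equiv.swap_apply_right]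
      exact Or.inr ⟨Or.inr h1, Or.inl SameCycle.rfl⟩
    rw [Equiv.swap_apply_of_ne_of_ne ha hb]
    exact Or.inl h1

lemma merge_cyc {u : Equiv.Perm (Fin n)} {a b : Fin n} (h : ¬ SameCycle u a b) :
    cyc (Equiv.swap a b * u) + 1 = cyc u := by
  classical
  have hs := merge_same h
  let S := Quotient (SameCycle.setoid u)
  let bq : S := Quotient.mk (SameCycle.setoid u) b
  let f : S → Quotient (SameCycle.setoid (Equiv.swap a b * u)) :=
    Quotient.map' id (fun x y hxy => merge_mono hs hxy)
  have hf : ∀ x, f (Quotient.mk (SameCycle.setoid u) x) = Quotient.mk (SameCycle.setoid (Equiv.swap a b * u)) x := fun x => rfl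
  have hbij : Function.Bijective (fun x : {x : S // x ≠ bq} => f x.1) := by
    constructor
    · rintro ⟨x, hx⟩ ⟨y, hy⟩ hxy
      induction x using Quotient.inductionOn with | _ x => ?_
      induction y using Quotient.inductionOn with | _ y => ?_
      simp only [hf] at hxy
      have hxy' : SameCycle (Equiv.swap a b * u) x y := Quotient.exact hxy
      have hxb : ¬ SameCycle u x b := fun h' => hx (Quotient.sound h')
      have hyb : ¬ SameCycle u y b := fun h' => hy (Quotient.sound h')
      apply Subtype.ext
      apply Quotient.sound
      show SameCycle u x y
      rcases merge_conv hxy' with h' | ⟨h1 | h1, h2 | h2⟩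
      · exact h'
      · exact h1.trans h2.symm
      all_goals contradiction
    · intro y
      induction y using Quotient.inductionOn with | _ y => ?_
      by_cases hy : SameCycle u y b
      · refine ⟨⟨Quotient.mk (SameCycle.setoid u) a, fun h' => h (Quotient.exact h')⟩, ?_⟩
        simp only [hf]
        exact Quotient.sound (hs.trans (merge_mono hs hy).symm)
      · exact ⟨⟨Quotient.mk (SameCycle.setoid u) y, fun h' => hy (Quotient.exact h')⟩, hf y⟩
  have hc := Nat.card_eq_of_bijective _ hbij
  unfold cyc
  rw [← hc]
  have : Nat.card {x : S // x ≠ bq} = Nat.card S - 1 := by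
    have := Fintype.ofFinite S
    rw [Nat.card_eq_fintype_card, Nat.card_eq_fintype_card, Fintype.card_subtype_compl]
    simp
  have hpos : 0 < Nat.card S := Nat.card_pos_iff.2 ⟨⟨bq⟩, inferInstance⟩
  show Nat.card {x : S // x ≠ bq} + 1 = Nat.card S
  omega

lemma cyc_congr {u w : Equiv.Perm (Fin n)} (h : ∀ x y, SameCycle u x y ↔ SameCycle w x y) :
    cyc u = cyc w := by
  unfold cyc
  have : SameCycle.setoid u = SameCycle.setoid w := Setoid.ext h
  rw [this]

lemma cyc_conj (u g : Equiv.Perm (Fin n)) : cyc (g * u * g⁻¹) = cyc u := by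
  unfold cyc
  refine (Nat.card_congr (Quotient.congr g ?_)).symm
  intro x y
  show SameCycle u x y ↔ SameCycle (g * u * g⁻¹) (g x) (g y)
  rw [sameCycle_conj]; simp

lemma cyc_one : cyc (1 : Equiv.Perm (Fin n)) = n := by
  unfold cyc
  have : Function.Bijective (Quotient.mk (SameCycle.setoid (1 : Equiv.Perm (Fin n)))) := by
    refine ⟨fun x y h => ?_, Quotient.mk_surjective⟩
    have : SameCycle (1 : Equiv.Perm (Fin n)) x y := Quotient.exact h
    exact sameCycle_one.1 this
  rw [← Nat.card_eq_of_bijective _ this]; simp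

lemma cyc_le (u : Equiv.Perm (Fin n)) : cyc u ≤ n := by
  unfold cyc
  simpa using Nat.card_le_card_of_surjective (Quotient.mk (SameCycle.setoid u)) Quotient.mk_surjective

lemma prodLR_cons (t : Equiv.Perm (Fin n)) (l) : prodLR (t :: l) = prodLR l * t := by
  simp [prodLR]

lemma prodLR_append (l l' : List (Equiv.Perm (Fin n))) : prodLR (l ++ l') = prodLR l' * prodLR l := by
  simp [prodLR]

lemma exists_fact (u : Equiv.Perm (Fin n)) :
    ∃ l : List (Equiv.Perm (Fin n)), l.length + cyc u = n ∧ (∀ t ∈ l, t.IsSwap) ∧ prodLR l = u := by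
  induction hk : n - cyc u generalizing u with
  | zero =>
    have hu : u = 1 := by
      by_contra hne
      obtain ⟨a, ha⟩ : ∃ a, u a ≠ a := by
        by_contra! h; exact hne (Equiv.ext h)
      have h1 : ¬ SameCycle (Equiv.swap a (u a) * u) a (u a) := by
        intro h; apply ha; symm
        apply h.eq_of_left
        simp [Function.IsFixedPt]
      have := merge_cyc h1
      rw [← mul_assoc, Equiv.swap_mul_self, one_mul] at this
      have := cyc_le (Equiv.swap a (u a) * u)
      omega
    subst hu
    exact ⟨[], by simp [cyc_one], by simp, by simp [prodLR]⟩
  | succ k ih =>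
    have hne : u ≠ 1 := by rintro rfl; rw [cyc_one] at hk; omega
    obtain ⟨a, ha⟩ : ∃ a, u a ≠ a := by
      by_contra! h; exact hne (Equiv.ext h)
    have h1 : ¬ SameCycle (Equiv.swap a (u a) * u) a (u a) := by
      intro h; apply ha; symm
      apply h.eq_of_left
      simp [Function.IsFixedPt]
    have h2 := merge_cyc h1
    rw [← mul_assoc, Equiv.swap_mul_self, one_mul] at h2
    obtain ⟨l, hl1, hl2, hl3⟩ := ih (Equiv.swap a (u a) * u) (by omega)
    refine ⟨l ++ [Equiv.swap a (u a)], by simp; omega, ?_, ?_⟩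
    · intro t ht
      rcases List.mem_append.1 ht with ht | ht
      · exact hl2 t ht
      · rw [List.mem_singleton] at ht; subst ht
        exact ⟨a, u a, ha.symm, rfl⟩
    · rw [prodLR_append, hl3]; simp [prodLR]

lemma sign_prodLR {l : List (Equiv.Perm (Fin n))} (h : ∀ t ∈ l, t.IsSwap) :
    sign (prodLR l) = (-1) ^ l.length := by
  induction l with
  | nil => simp [prodLR]
  | cons t l ih =>
    rw [prodLR_cons, map_mul, ih (fun s hs => h s (List.mem_cons_of_mem _ hs)),
      (h t List.mem_cons_self).sign_eq, List.length_cons, pow_succ]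

lemma split_not_same {u : Equiv.Perm (Fin n)} {a b : Fin n} (hab : a ≠ b) (h : SameCycle u a b) :
    ¬ SameCycle (Equiv.swap a b * u) a b := by
  intro hs
  have e : Equiv.swap a b * (Equiv.swap a b * u) = u := by
    rw [← mul_assoc, Equiv.swap_mul_self, one_mul]
  have hc : cyc u = cyc (Equiv.swap a b * u) := by
    apply cyc_congr
    intro x y
    refine ⟨merge_mono hs, fun hxy => ?_⟩
    have := merge_mono (u := Equiv.swap a b * u) (a := a) (b := b) (by rw [e]; exact h) hxy
    rwa [e] at this
  obtain ⟨l, hl1, hl2, hl3⟩ := exists_fact u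
  obtain ⟨l', hl1', hl2', hl3'⟩ := exists_fact (Equiv.swap a b * u)
  have h1 := sign_prodLR hl2
  have h2 := sign_prodLR hl2'
  have h3 : l.length = l'.length := by omega
  rw [hl3] at h1
  rw [hl3', map_mul, h1, sign_swap hab, h3] at h2
  rcases Int.units_eq_one_or ((-1 : ℤˣ) ^ l'.length) with h | h <;> rw [h] at h2 <;> revert h2 <;> decide

lemma cyc_eq_one_iff_conj (hn : 2 ≤ n) (u : Equiv.Perm (Fin n)) :
    (∀ x y, SameCycle u x y) → IsConj (finRotate n) u := by
  intro h
  have hfix : ∀ x, u x ≠ x := by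
    intro x hx
    have : Nontrivial (Fin n) := Fin.nontrivial_iff_two_le.2 hn
    obtain ⟨y, hy⟩ := exists_ne x
    exact hy ((h x y).eq_of_left hx).symm
  have hc : IsCycle u := ⟨⟨0, by omega⟩, hfix _, fun y _ => h _ y⟩
  rw [isConj_iff_cycleType_eq, cycleType_finRotate_of_le hn, hc.cycleType]
  have : u.support = Finset.univ := by ext x; simp [hfix x]
  rw [this]; simp

lemma same_of_cyc_one {u : Equiv.Perm (Fin n)} (h : cyc u = 1) (x y) : SameCycle u x y := by
  unfold cyc at h
  obtain ⟨h1, h2⟩ := Nat.card_eq_one_iff_unique.1 h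
  exact Quotient.exact (h1.elim (Quotient.mk (SameCycle.setoid u) x) (Quotient.mk (SameCycle.setoid u) y))

lemma same_rot (hn : 2 ≤ n) (x y : Fin n) : SameCycle (finRotate n) x y := by
  have hs := support_finRotate_of_le hn
  apply (isCycle_finRotate_of_le hn).sameCycle
  · rw [← mem_support, hs]; simp
  · rw [← mem_support, hs]; simp

lemma cyc_rot (hn : 2 ≤ n) : cyc (finRotate n) = 1 := by
  unfold cyc
  rw [Nat.card_eq_one_iff_unique]
  refine ⟨⟨fun x y => ?_⟩, ⟨Quotient.mk _ ⟨0, by omega⟩⟩⟩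
  induction x using Quotient.inductionOn with | _ x => ?_
  induction y using Quotient.inductionOn with | _ y => ?_
  exact Quotient.sound (same_rot hn x y)

/-- the pair (s,t) is compatible -/
def Good {n : ℕ} (s t : Equiv.Perm (Fin n)) : Prop := ∀ x, SameCycle (t * finRotate n) x (s x)

lemma good_cyc (hn : 2 ≤ n) (f : List (Equiv.Perm (Fin n))) (hf : ∀ t ∈ f, t.IsSwap)
    (hg : f.Pairwise Good) : cyc (finRotate n * (prodLR f)⁻¹) = 1 + f.length := by
  induction f using List.reverseRecOn with
  | nil => simp [prodLR, cyc_rot hn]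
  | append_singleton f t ih =>
    rw [List.pairwise_append] at hg
    have ih' := ih (fun s hs => hf s (by simp [hs])) hg.1
    obtain ⟨a, b, hab, ht⟩ := hf t (by simp)
    have hgood : ∀ s ∈ f, Good s t := fun s hs => hg.2.2 s hs t (by simp)
    have hσ : ∀ x, SameCycle (t * finRotate n) x (prodLR f x) := by
      clear ih ih' hg hf
      induction f with
      | nil => intro x; simp [prodLR, SameCycle.rfl]
      | cons s f ih =>
        intro x
        rw [prodLR_cons, Equiv.Perm.mul_apply]
        exact (hgood s (by simp) x).trans (ih (fun s hs => hgood s (by simp [hs])) _)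
    have hu : ¬ SameCycle (t * finRotate n * (prodLR f)⁻¹) a b := by
      intro h
      have : SameCycle (t * finRotate n) a b := by
        refine sameCycle_le (fun x => ?_) h
        rw [Equiv.Perm.mul_apply, sameCycle_apply_right]
        have := hσ ((prodLR f)⁻¹ x)
        have e : prodLR f ((prodLR f)⁻¹ x) = x := by
          rw [← Equiv.Perm.mul_apply, mul_inv_cancel, Equiv.Perm.one_apply]
        rw [e] at this
        exact this.symm
      rw [ht] at this
      exact split_not_same hab (same_rot hn a b) this
    have hm := merge_cyc hu
    have htt : t * t = 1 := by rw [ht]; exact Equiv.swap_mul_self a b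
    have hti : t⁻¹ = t := by rw [ht]; exact Equiv.swap_inv a b
    rw [← ht, ← mul_assoc, ← mul_assoc, htt, one_mul, ih'] at hm
    have : finRotate n * (prodLR (f ++ [t]))⁻¹ = t * (t * finRotate n * (prodLR f)⁻¹) * t⁻¹ := by
      rw [prodLR_append]
      have : prodLR [t] = t := by simp [prodLR]
      rw [this, mul_inv_rev, ← mul_assoc, ← mul_assoc, ← mul_assoc, htt, one_mul]
    rw [this, cyc_conj, ← hm]
    simp; omega

lemma genus_zero (hn : 2 ≤ n) (f : List (Equiv.Perm (Fin n))) (hf : ∀ t ∈ f, t.IsSwap)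
    (hg : f.Pairwise Good) : genus n f = 0 := by
  obtain ⟨l, h1, h2, h3⟩ := exists_fact (finRotate n * (prodLR f)⁻¹)
  rw [good_cyc hn f hf hg] at h1
  unfold genus
  rw [Nat.sInf_eq_zero]
  left
  refine ⟨f ++ l, List.prefix_append _ _, ?_, ?_, ?_⟩
  · simp; omega
  · intro t ht
    rcases List.mem_append.1 ht with ht | ht
    · exact hf t ht
    · exact h2 t ht
  · rw [prodLR_append, h3]; simp

lemma bad_conj (hn : 2 ≤ n) {s t : Equiv.Perm (Fin n)} (hs : s.IsSwap) (ht : t.IsSwap)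
    (hb : ¬ Good s t) : IsConj (finRotate n) (finRotate n * s⁻¹ * t⁻¹) := by
  obtain ⟨a, b, hab, hteq⟩ := ht
  obtain ⟨x, y, hxy, hseq⟩ := hs
  have htt : t * t = 1 := by rw [hteq]; exact Equiv.swap_mul_self a b
  have hti : t⁻¹ = t := by rw [hteq]; exact Equiv.swap_inv a b
  have hss : s * s = 1 := by rw [hseq]; exact Equiv.swap_mul_self x y
  have hsi : s⁻¹ = s := by rw [hseq]; exact Equiv.swap_inv x y
  have hw : cyc (t * finRotate n) = 2 := by
    have := split_not_same hab (same_rot hn a b)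
    have := merge_cyc this
    rw [← hteq, ← mul_assoc, htt, one_mul, cyc_rot hn] at this
    omega
  have hns : ¬ SameCycle (t * finRotate n) x y := by
    intro h
    apply hb
    intro z
    by_cases hz : z = x
    · subst hz; rw [hseq, Equiv.swap_apply_left]; exact h
    by_cases hz' : z = y
    · subst hz'; rw [hseq, Equiv.swap_apply_right]; exact h.symm
    rw [hseq, Equiv.swap_apply_of_ne_of_ne hz hz']
  have hm := merge_cyc hns
  rw [← hseq, hw] at hm
  apply cyc_eq_one_iff_conj hn
  apply same_of_cyc_one
  have : finRotate n * s⁻¹ * t⁻¹ = (s * t)⁻¹ * (s * (t * finRotate n)) * (s * t)⁻¹⁻¹ := by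
    rw [hsi, hti]; group
  rw [this, cyc_conj]; omega

end perms

section counting
open Equiv.Perm
variable {n : ℕ}

def Wset (m : ℕ) (r : Equiv.Perm (Fin n)) : Set (List (Equiv.Perm (Fin n))) :=
  {l | l.length = m ∧ (∀ t ∈ l, t.IsSwap) ∧ prodLR l = r}

noncomputable def W (m : ℕ) (r : Equiv.Perm (Fin n)) : ℕ := (Wset m r).ncard

lemma Wset_finite (m : ℕ) (r : Equiv.Perm (Fin n)) : (Wset m r).Finite :=
  (List.finite_length_eq (Equiv.Perm (Fin n)) m).subset fun _ h => h.1

lemma isSwap_conj {t : Equiv.Perm (Fin n)} (g : Equiv.Perm (Fin n)) (h : t.IsSwap) :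
    (g * t * g⁻¹).IsSwap := by
  obtain ⟨a, b, hab, rfl⟩ := h
  exact ⟨g a, g b, fun h => hab (g.injective h), (Equiv.swap_apply_apply g a b).symm⟩

lemma prodLR_map_conj (g : Equiv.Perm (Fin n)) (l : List (Equiv.Perm (Fin n))) :
    prodLR (l.map fun r => g * r * g⁻¹) = g * prodLR l * g⁻¹ := by
  induction l with
  | nil => simp [prodLR]
  | cons t l ih => rw [List.map_cons, prodLR_cons, prodLR_cons, ih]; group

lemma conj_inj (g : Equiv.Perm (Fin n)) : Function.Injective (fun r => g * r * g⁻¹) :=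
  fun a b h => by simpa using h

lemma W_conj_le (m : ℕ) (r g : Equiv.Perm (Fin n)) : W m r ≤ W m (g * r * g⁻¹) := by
  refine Set.ncard_le_ncard_of_injOn (fun l => l.map fun r => g * r * g⁻¹) ?_ ?_ (Wset_finite _ _)
  · rintro l ⟨h1, h2, h3⟩
    refine ⟨by simp [h1], ?_, by rw [prodLR_map_conj, h3]⟩
    intro t ht
    obtain ⟨s, hs, rfl⟩ := List.mem_map.1 ht
    exact isSwap_conj g (h2 s hs)
  · exact (List.map_injective_iff.2 (conj_inj g)).injOn

lemma W_isConj (m : ℕ) {r r' : Equiv.Perm (Fin n)} (h : IsConj r r') : W m r = W m r' := by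
  obtain ⟨g, rfl⟩ := isConj_iff.1 h
  apply le_antisymm (W_conj_le m r g)
  have := W_conj_le m (g * r * g⁻¹) g⁻¹
  have e : g⁻¹ * (g * r * g⁻¹) * g⁻¹⁻¹ = r := by group
  rw [e] at this
  exact this

def pull (i : ℕ) (s : Equiv.Perm (Fin n)) (F : List (Equiv.Perm (Fin n))) :
    List (Equiv.Perm (Fin n)) :=
  ((F.take i).map fun r => s * r * s⁻¹) ++ F.drop (i+1)

lemma split_at {F : List (Equiv.Perm (Fin n))} {i : ℕ} {s : Equiv.Perm (Fin n)}
    (h : F[i]? = some s) : F = F.take i ++ s :: F.drop (i+1) := by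
  obtain ⟨hi, rfl⟩ := List.getElem?_eq_some_iff.1 h
  simp

lemma pull_mem {m i : ℕ} {r s : Equiv.Perm (Fin n)} {F : List (Equiv.Perm (Fin n))}
    (hF : F ∈ Wset (m+1) r) (h : F[i]? = some s) : pull i s F ∈ Wset m (r * s⁻¹) := by
  obtain ⟨h1, h2, h3⟩ := hF
  obtain ⟨hi, -⟩ := List.getElem?_eq_some_iff.1 h
  refine ⟨by simp [pull]; omega, ?_, ?_⟩
  · intro t ht
    rcases List.mem_append.1 ht with ht | ht
    · obtain ⟨s', hs', rfl⟩ := List.mem_map.1 ht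
      exact isSwap_conj _ (h2 _ (List.mem_of_mem_take hs'))
    · exact h2 _ (List.mem_of_mem_drop ht)
  · rw [pull, prodLR_append, prodLR_map_conj, ← h3]
    conv_rhs => rw [split_at h, prodLR_append, prodLR_cons]
    group

lemma pull_inj {i : ℕ} {s : Equiv.Perm (Fin n)} {F F' : List (Equiv.Perm (Fin n))}
    (h : F[i]? = some s) (h' : F'[i]? = some s) (he : pull i s F = pull i s F') : F = F' := by
  obtain ⟨hi, -⟩ := List.getElem?_eq_some_iff.1 h
  obtain ⟨hi', -⟩ := List.getElem?_eq_some_iff.1 h'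
  obtain ⟨e1, e2⟩ := List.append_inj he (by simp; omega)
  rw [split_at h, split_at h', List.map_injective_iff.2 (conj_inj s) e1, e2]

lemma pull_get {i j : ℕ} (hij : i < j) {s : Equiv.Perm (Fin n)} {F : List (Equiv.Perm (Fin n))}
    (h : F[i]? = some s) : (pull i s F)[j-1]? = F[j]? := by
  obtain ⟨hi, -⟩ := List.getElem?_eq_some_iff.1 h
  have hl : ((F.take i).map fun r => s * r * s⁻¹).length = i := by simp; omega
  rw [pull, List.getElem?_append_right (by omega), hl, List.getElem?_drop]
  congr 1; omega

lemma pair_count {m i j : ℕ} (hij : i < j) (r s t : Equiv.Perm (Fin n)) :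
    {F | F ∈ Wset (m+2) r ∧ F[i]? = some s ∧ F[j]? = some t}.ncard ≤ W m (r * s⁻¹ * t⁻¹) := by
  refine Set.ncard_le_ncard_of_injOn (fun F => pull (j-1) t (pull i s F)) ?_ ?_ (Wset_finite _ _)
  · rintro F ⟨h1, h2, h3⟩
    exact pull_mem (pull_mem h1 h2) (by rw [pull_get hij h2, h3])
  · rintro F ⟨h1, h2, h3⟩ F' ⟨h1', h2', h3'⟩ he
    exact pull_inj h2 h2' (pull_inj (by rw [pull_get hij h2, h3]) (by rw [pull_get hij h2', h3']) he)

lemma bad_pair_count (hn : 2 ≤ n) {m i j : ℕ} (hij : i < j) :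
    {F | F ∈ Wset (m+2) (finRotate n) ∧ ∃ s t, F[i]? = some s ∧ F[j]? = some t ∧ ¬ Good s t}.ncard
      ≤ n ^ 4 * W m (finRotate n) := by
  classical
  let P := (Fin n × Fin n) × (Fin n × Fin n)
  let A : P → Set (List (Equiv.Perm (Fin n))) := fun p =>
    {F | (F ∈ Wset (m+2) (finRotate n) ∧ F[i]? = some (Equiv.swap p.1.1 p.1.2) ∧
      F[j]? = some (Equiv.swap p.2.1 p.2.2)) ∧ ¬ Good (Equiv.swap p.1.1 p.1.2) (Equiv.swap p.2.1 p.2.2)}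
  have hfin : (⋃ p ∈ (Finset.univ : Finset P), A p).Finite := by
    refine (Wset_finite (m+2) (finRotate n)).subset ?_
    intro F hF
    simp only [Set.mem_iUnion] at hF
    obtain ⟨p, _, hp⟩ := hF
    exact hp.1.1
  have hA : ∀ p, (A p).ncard ≤ W m (finRotate n) := by
    intro p
    by_cases he : (A p).Nonempty
    · obtain ⟨F, ⟨⟨_, h2, _⟩, h3, h4⟩, h5⟩ := he
      rw [W_isConj m (bad_conj hn (h2 _ (List.mem_of_getElem? h3)) (h2 _ (List.mem_of_getElem? h4)) h5)]
      refine le_trans (Set.ncard_le_ncard ?_ ?_) (pair_count hij _ _ _)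
      · exact fun F hF => hF.1
      · exact (Wset_finite _ _).subset fun F hF => hF.1
    · rw [Set.not_nonempty_iff_eq_empty.1 he]; simp
  calc _ ≤ (⋃ p ∈ (Finset.univ : Finset P), A p).ncard := by
        refine Set.ncard_le_ncard ?_ hfin
        rintro F ⟨h1, s, t, h2, h3, h4⟩
        obtain ⟨a, b, _, rfl⟩ := h1.2.1 s (List.mem_of_getElem? h2)
        obtain ⟨x, y, _, rfl⟩ := h1.2.1 t (List.mem_of_getElem? h3)
        simp only [Set.mem_iUnion]
        exact ⟨((a, b), (x, y)), Finset.mem_univ _, ⟨h1, h2, h3⟩, h4⟩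
    _ ≤ ∑ p : P, (A p).ncard := Finset.set_ncard_biUnion_le _ _
    _ ≤ ∑ p : P, W m (finRotate n) := Finset.sum_le_sum fun p _ => hA p
    _ = _ := by
      simp [P]; left; ring

lemma bad_count (hn : 2 ≤ n) (m k : ℕ) :
    {F | F ∈ Wset (m+2) (finRotate n) ∧ genus n (F.take k) ≠ 0}.ncard
      ≤ k ^ 2 * (n ^ 4 * W m (finRotate n)) := by
  classical
  let A : ℕ × ℕ → Set (List (Equiv.Perm (Fin n))) := fun p =>
    {F | p.1 < p.2 ∧ F ∈ Wset (m+2) (finRotate n) ∧ ∃ s t, F[p.1]? = some s ∧ F[p.2]? = some t ∧ ¬ Good s t}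
  let S := Finset.range k ×ˢ Finset.range k
  have hfin : (⋃ p ∈ S, A p).Finite := by
    refine (Wset_finite (m+2) (finRotate n)).subset ?_
    intro F hF
    simp only [Set.mem_iUnion] at hF
    obtain ⟨p, _, hp⟩ := hF
    exact hp.2.1
  have hA : ∀ p, (A p).ncard ≤ n ^ 4 * W m (finRotate n) := by
    intro p
    by_cases hp : p.1 < p.2
    · refine le_trans (Set.ncard_le_ncard ?_ ?_) (bad_pair_count (m := m) hn hp)
      · exact fun F hF => hF.2
      · exact (Wset_finite _ _).subset fun F hF => hF.1
    · have : A p = ∅ := by ext F; simp [A, hp]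
      rw [this]; simp
  calc _ ≤ (⋃ p ∈ S, A p).ncard := by
        refine Set.ncard_le_ncard ?_ hfin
        rintro F ⟨h1, h2⟩
        have h3 : ¬ (F.take k).Pairwise Good := fun h => h2
          (genus_zero hn _ (fun t ht => h1.2.1 t (List.mem_of_mem_take ht)) h)
        rw [List.pairwise_iff_getElem] at h3
        push Not at h3
        obtain ⟨i, j, hi, hj, hij, hb⟩ := h3
        simp only [Set.mem_iUnion]
        have hi' : i < F.length := by rw [List.length_take] at hi; omega
        have hj' : j < F.length := by rw [List.length_take] at hj; omega
        refine ⟨(i, j), ?_, hij, h1, F[i], F[j], by simp [hi'], by simp [hj'], by simpa using hb⟩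
        rw [List.length_take] at hi hj
        simp [S]; omega
    _ ≤ ∑ p ∈ S, (A p).ncard := Finset.set_ncard_biUnion_le _ _
    _ ≤ ∑ p ∈ S, n ^ 4 * W m (finRotate n) := Finset.sum_le_sum fun p _ => hA p
    _ = _ := by
      simp [S]; left; ring

end counting

section det
open Matrix Polynomial
variable {n : ℕ}

lemma derivative_det' (M : Matrix (Fin n) (Fin n) ℚ[X]) :
    derivative M.det = ∑ i, ∑ j, derivative (M i j) * M.adjugate j i := by
  have h1 : ∀ i, ∑ j, derivative (M i j) * M.adjugate j i
      = (M.updateRow i (fun j => derivative (M i j))).det := by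
    intro i
    rw [det_eq_sum_mul_adjugate_row _ i]
    refine Finset.sum_congr rfl fun j _ => ?_
    rw [updateRow_self, adjugate_apply, adjugate_apply, updateRow_idem]
  simp_rw [h1]
  simp_rw [← det_transpose M, ← fun i => det_transpose (M.updateRow i (fun j => derivative (M i j)))]
  simp_rw [det_apply, derivative_sum]
  rw [Finset.sum_comm]
  refine Finset.sum_congr rfl fun σ _ => ?_
  rw [← Finset.smul_sum]
  have : ∀ p : ℚ[X], derivative (Equiv.Perm.sign σ • p) = Equiv.Perm.sign σ • derivative p := by
    intro p
    rcases Int.units_eq_one_or (Equiv.Perm.sign σ) with h | h <;> simp [h]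
  rw [this, derivative_prod_finset]
  congr 1
  refine Finset.sum_congr rfl fun i _ => ?_
  rw [← Finset.mul_prod_erase Finset.univ _ (Finset.mem_univ i), mul_comm]
  simp only [transpose_apply, updateRow_self]
  congr 1
  refine Finset.prod_congr rfl fun j hj => ?_
  rw [updateRow_ne (Finset.ne_of_mem_erase hj)]

lemma det_rank_one_field {K : Type*} [Field K] (A : Matrix (Fin n) (Fin n) K) (hA : A.det ≠ 0)
    (u v : Fin n → K) :
    (A + vecMulVec u v).det = A.det + v ⬝ᵥ (A.adjugate *ᵥ u) := by
  have h := det_add_replicateCol_mul_replicateRow (ι := Unit) hA.isUnit u v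
  rw [← vecMulVec_eq] at h
  rw [h, det_unique (n := Unit), Matrix.add_apply, one_apply_eq]
  have : (replicateRow Unit v * A⁻¹ * replicateCol Unit u) default default
      = (A.det)⁻¹ * (v ⬝ᵥ (A.adjugate *ᵥ u)) := by
    rw [Matrix.mul_assoc, ← replicateCol_mulVec, replicateRow_mul_replicateCol_apply, inv_def,
      smul_mulVec, dotProduct_smul, Ring.inverse_eq_inv', smul_eq_mul]
  rw [this, mul_add, mul_one, ← mul_assoc, mul_inv_cancel₀ hA, one_mul]

lemma det_rank_one {R : Type*} [CommRing R] [IsDomain R] (A : Matrix (Fin n) (Fin n) R) (hA : A.det ≠ 0)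
    (u v : Fin n → R) :
    (A + vecMulVec u v).det = A.det + v ⬝ᵥ (A.adjugate *ᵥ u) := by
  let K := FractionRing R
  let φ : R →+* K := algebraMap R K
  have hφ : Function.Injective φ := IsFractionRing.injective R K
  apply hφ
  have hu : (φ.mapMatrix A).det ≠ 0 := by
    rw [← RingHom.map_det]
    exact (map_ne_zero_iff φ hφ).2 hA
  have h := det_rank_one_field _ hu (φ ∘ u) (φ ∘ v)
  rw [RingHom.map_det, map_add φ A.det, RingHom.map_det, RingHom.map_dotProduct]
  have e1 : φ.mapMatrix (A + vecMulVec u v) = φ.mapMatrix A + vecMulVec (φ ∘ u) (φ ∘ v) := by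
    ext i j; simp [vecMulVec_apply]
  have e2 : φ ∘ (A.adjugate *ᵥ u) = (φ.mapMatrix A).adjugate *ᵥ (φ ∘ u) := by
    rw [← RingHom.map_adjugate]
    ext i
    simp [mulVec, dotProduct]
  rw [e1, e2, h]

lemma perm_apply' (s : Equiv.Perm (Fin n)) (i j : Fin n) :
    s.permMatrix ℚ[X] i j = if s i = j then 1 else 0 := by
  simp [Equiv.Perm.permMatrix, PEquiv.toMatrix_apply, Equiv.toPEquiv_apply, eq_comm]

noncomputable def Mx (s : Equiv.Perm (Fin n)) : Matrix (Fin n) (Fin n) ℚ[X] :=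
  1 - (X : ℚ[X]) • s.permMatrix ℚ[X]

/-- sum of the entries of the adjugate -/
noncomputable def Jp (s : Equiv.Perm (Fin n)) : ℚ[X] := ∑ i, ∑ j, (Mx s).adjugate i j

lemma Mx_mulVec_one (s : Equiv.Perm (Fin n)) : Mx s *ᵥ 1 = (1 - X : ℚ[X]) • (1 : Fin n → ℚ[X]) := by
  rw [Mx, sub_mulVec, one_mulVec, smul_mulVec, permMatrix_mulVec, sub_smul, one_smul]
  rfl

lemma Jp_eq (s : Equiv.Perm (Fin n)) : (1 - X) * Jp s = (n : ℚ[X]) * (Mx s).det := by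
  have h1 : (Mx s).adjugate *ᵥ (Mx s *ᵥ 1) = (Mx s).det • (1 : Fin n → ℚ[X]) := by
    rw [mulVec_mulVec, adjugate_mul, smul_mulVec, one_mulVec]
  rw [Mx_mulVec_one, mulVec_smul] at h1
  have h2 : ∀ i, (1 - X) * ∑ j, (Mx s).adjugate i j = (Mx s).det := by
    intro i
    have := congrFun h1 i
    simpa [mulVec, dotProduct] using this
  rw [Jp, Finset.mul_sum]
  simp [h2]

lemma X_perm_adj (s : Equiv.Perm (Fin n)) :
    (X : ℚ[X]) • (s.permMatrix ℚ[X] * (Mx s).adjugate) = (Mx s).adjugate - (Mx s).det • 1 := by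
  have h := mul_adjugate (Mx s)
  nth_rewrite 1 [Mx] at h
  rw [Matrix.sub_mul, Matrix.one_mul, Matrix.smul_mul] at h
  rw [← h]; abel

lemma X_derivative_det (s : Equiv.Perm (Fin n)) :
    X * derivative (Mx s).det = (n : ℚ[X]) * (Mx s).det - (Mx s).adjugate.trace := by
  have h1 : derivative (Mx s).det = - (s.permMatrix ℚ[X] * (Mx s).adjugate).trace := by
    rw [derivative_det', trace, ← Finset.sum_neg_distrib]
    refine Finset.sum_congr rfl fun i _ => ?_
    rw [diag_apply, Matrix.mul_apply, ← Finset.sum_neg_distrib]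
    refine Finset.sum_congr rfl fun j _ => ?_
    rw [← neg_mul]
    congr 1
    rw [Mx, Matrix.sub_apply, Matrix.smul_apply, perm_apply', one_apply]
    split_ifs <;> simp
  have h2 := congrArg trace (X_perm_adj s)
  rw [trace_smul, trace_sub, trace_smul, trace_one, smul_eq_mul] at h2
  rw [h1, mul_neg, h2]
  simp; ring

lemma det_ne_zero (s : Equiv.Perm (Fin n)) : (Mx s).det ≠ 0 := by
  intro h
  have h1 := congrArg (eval 0) h
  have h2 : (evalRingHom (0:ℚ)) (Mx s).det = 1 := by
    rw [RingHom.map_det]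
    have : (evalRingHom (0:ℚ)).mapMatrix (Mx s) = 1 := by
      ext i j
      rw [RingHom.mapMatrix_apply, map_apply, Mx, Matrix.sub_apply, Matrix.smul_apply, perm_apply', one_apply, one_apply, coe_evalRingHom]
      split_ifs <;> simp
    rw [this, det_one]
  rw [coe_evalRingHom, h1] at h2
  simp at h2

lemma perm_swap {a b : Fin n} (hab : a ≠ b) :
    (Equiv.swap a b).permMatrix ℚ[X] = 1 - vecMulVec (Pi.single a 1 - Pi.single b 1)
      (Pi.single a 1 - Pi.single b 1) := by
  ext i j : 2
  rw [perm_apply', Matrix.sub_apply, vecMulVec_apply, one_apply]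
  simp only [Pi.sub_apply, Pi.single_apply]
  by_cases ha : i = a
  · subst ha
    by_cases hj : j = i
    · subst hj; simp [hab, hab.symm]
    · by_cases hj' : j = b
      · subst hj'; simp [hab, hab.symm]
      · simp [hab, hj, hj', Ne.symm hj, Ne.symm hj']
  · by_cases hb : i = b
    · subst hb
      by_cases hj : j = i
      · subst hj; simp [hab, hab.symm]
      · by_cases hj' : j = a
        · subst hj'; simp [hab, hab.symm]
        · simp [hj, hj', Ne.symm hj, Ne.symm hj', hab.symm]
    · rw [Equiv.swap_apply_of_ne_of_ne ha hb]
      simp [ha, hb]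

lemma det_swap (s : Equiv.Perm (Fin n)) {a b : Fin n} (hab : a ≠ b) :
    (Mx (s * Equiv.swap a b)).det = (Mx s).adjugate a a + (Mx s).adjugate b b
      - (Mx s).adjugate a b - (Mx s).adjugate b a - (Mx s).det := by
  set v : Fin n → ℚ[X] := Pi.single a 1 - Pi.single b 1 with hv
  have e : Mx (s * Equiv.swap a b) = Mx s + vecMulVec v ((X : ℚ[X]) • (v ᵥ* s.permMatrix ℚ[X])) := by
    rw [Mx, permMatrix_mul, perm_swap hab, ← hv, Mx, Matrix.sub_mul, Matrix.one_mul, vecMulVec_smul,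
      vecMulVec_mul, smul_sub]
    abel
  rw [e, det_rank_one _ (det_ne_zero s), smul_dotProduct, ← dotProduct_mulVec, mulVec_mulVec,
    ← dotProduct_smul, ← smul_mulVec, X_perm_adj, sub_mulVec, smul_mulVec, one_mulVec, hv]
  simp [sub_dotProduct, mulVec_sub, hab, hab.symm]
  ring

end det

section cutjoin
open Matrix Polynomial
variable {n : ℕ}

noncomputable def Sw (n : ℕ) : Finset (Equiv.Perm (Fin n)) := by
  classical exact Finset.univ.filter fun t => t.IsSwap

lemma mem_Sw {t : Equiv.Perm (Fin n)} : t ∈ Sw n ↔ t.IsSwap := by simp [Sw]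

lemma sum_swaps (f : Equiv.Perm (Fin n) → ℚ[X]) :
    ∑ p ∈ (Finset.univ : Finset (Fin n)).offDiag, f (Equiv.swap p.1 p.2) = 2 * ∑ t ∈ Sw n, f t := by
  classical
  rw [Finset.sum_comp f (fun p : Fin n × Fin n => Equiv.swap p.1 p.2), Finset.mul_sum]
  have himg : (Finset.univ : Finset (Fin n)).offDiag.image (fun p => Equiv.swap p.1 p.2) = Sw n := by
    ext t
    rw [mem_Sw, Finset.mem_image]
    constructor
    · rintro ⟨p, hp, rfl⟩
      exact ⟨p.1, p.2, (Finset.mem_offDiag.1 hp).2.2, rfl⟩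
    · rintro ⟨a, b, hab, rfl⟩
      exact ⟨(a, b), by simp [hab], rfl⟩
  rw [himg]
  refine Finset.sum_congr rfl fun t ht => ?_
  obtain ⟨a, b, hab, rfl⟩ := mem_Sw.1 ht
  have : {p ∈ (Finset.univ : Finset (Fin n)).offDiag | Equiv.swap p.1 p.2 = Equiv.swap a b}
      = {(a, b), (b, a)} := by
    ext ⟨x, y⟩
    simp only [Finset.mem_filter, Finset.mem_offDiag, Finset.mem_univ, true_and, Finset.mem_insert,
      Finset.mem_singleton, Prod.mk.injEq]
    constructor
    · rintro ⟨hxy, he⟩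
      have h1 : Equiv.swap a b x = y := by rw [← he, Equiv.swap_apply_left]
      by_cases hx : x = a
      · subst hx; rw [Equiv.swap_apply_left] at h1; exact Or.inl ⟨rfl, h1.symm⟩
      by_cases hx' : x = b
      · subst hx'; rw [Equiv.swap_apply_right] at h1; exact Or.inr ⟨rfl, h1.symm⟩
      rw [Equiv.swap_apply_of_ne_of_ne hx hx'] at h1
      exact absurd h1 hxy
    · rintro (⟨rfl, rfl⟩ | ⟨rfl, rfl⟩)
      · exact ⟨hab, rfl⟩
      · exact ⟨hab.symm, Equiv.swap_comm _ _⟩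
  rw [this, Finset.card_pair]
  · simp
  · intro h; exact hab (Prod.mk.inj h).1

lemma one_sub_X_ne : (1 - X : ℚ[X]) ≠ 0 := by
  intro h
  have := congrArg (eval 0) h
  simp at this

lemma cutjoin (s : Equiv.Perm (Fin n)) :
    ∑ t ∈ Sw n, Jp (s * t) = C ((n : ℚ) * (n - 1) / 2) * Jp s - (n : ℚ[X]) * (X * derivative (Jp s)) := by
  have hJ := Jp_eq s
  have hD := X_derivative_det s
  have hJ' : -Jp s + (1 - X) * derivative (Jp s) = (n : ℚ[X]) * derivative (Mx s).det := by
    have := congrArg derivative hJ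
    simpa using this
  have hsum : ∑ p ∈ (Finset.univ : Finset (Fin n)).offDiag, (Mx (s * Equiv.swap p.1 p.2)).det
      = 2 * (n : ℚ[X]) * (Mx s).adjugate.trace - 2 * Jp s - (n : ℚ[X]) * (n - 1) * (Mx s).det := by
    have h1 : ∀ p ∈ (Finset.univ : Finset (Fin n)).offDiag, (Mx (s * Equiv.swap p.1 p.2)).det
        = ((Mx s).adjugate p.1 p.1 + (Mx s).adjugate p.2 p.2
      - (Mx s).adjugate p.1 p.2 - (Mx s).adjugate p.2 p.1) - (Mx s).det := by
      intro p hp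
      exact det_swap s (Finset.mem_offDiag.1 hp).2.2
    rw [Finset.sum_congr rfl h1, Finset.sum_sub_distrib]
    have h2 : ∑ p ∈ (Finset.univ : Finset (Fin n)).offDiag, ((Mx s).adjugate p.1 p.1 + (Mx s).adjugate p.2 p.2
      - (Mx s).adjugate p.1 p.2 - (Mx s).adjugate p.2 p.1) = ∑ p : Fin n × Fin n, ((Mx s).adjugate p.1 p.1 + (Mx s).adjugate p.2 p.2
      - (Mx s).adjugate p.1 p.2 - (Mx s).adjugate p.2 p.1) := by
      apply Finset.sum_subset (Finset.subset_univ _)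
      rintro ⟨x, y⟩ _ hxy
      have : x = y := by simpa using hxy
      subst this
      ring
    rw [h2, Fintype.sum_prod_type]
    simp only [Finset.sum_sub_distrib, Finset.sum_add_distrib, Finset.sum_const, Finset.offDiag_card,
      Finset.card_univ, Fintype.card_fin]
    rw [Finset.sum_comm (f := fun x y => (Mx s).adjugate y x)]
    simp only [trace, diag_apply, Jp, nsmul_eq_mul, ← Finset.mul_sum]
    rw [Nat.cast_sub (Nat.le_mul_self n)]
    push_cast
    ring
  have h3 := sum_swaps (fun t => (Mx (s * t)).det)
  rw [hsum] at h3
  have h4 : (1 - X) * ∑ t ∈ Sw n, Jp (s * t) = (n : ℚ[X]) * ∑ t ∈ Sw n, (Mx (s * t)).det := by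
    rw [Finset.mul_sum, Finset.mul_sum]
    exact Finset.sum_congr rfl fun t _ => Jp_eq _
  have hC : (2 : ℚ[X]) * C ((n : ℚ) * (n - 1) / 2) = n * (n - 1) := by
    have : (2 : ℚ[X]) = C 2 := rfl
    rw [this, ← C_mul, mul_div_cancel₀ _ (two_ne_zero)]
    simp
  have h2 : (2 : ℚ[X]) * (1 - X) ≠ 0 := mul_ne_zero two_ne_zero one_sub_X_ne
  apply mul_left_cancel₀ h2
  linear_combination 2 * h4 - (n:ℚ[X]) * h3 - (1 - X) * Jp s * hC + 2 * (n:ℚ[X]) * X * hJ' + 2 * (n : ℚ[X])^2 * hD - (n : ℚ[X]) * (n + 1) * hJ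

lemma Jp_one (hn : 1 ≤ n) : Jp (1 : Equiv.Perm (Fin n)) = (n : ℚ[X]) * (1 - X) ^ (n - 1) := by
  apply mul_left_cancel₀ one_sub_X_ne
  rw [Jp_eq]
  have : Mx (1 : Equiv.Perm (Fin n)) = (1 - X : ℚ[X]) • 1 := by
    rw [Mx, permMatrix_one, sub_smul, one_smul]
  rw [this, det_smul, det_one, Fintype.card_fin]
  obtain ⟨k, rfl⟩ : ∃ k, n = k + 1 := ⟨n - 1, by omega⟩
  simp only [Nat.add_sub_cancel]
  ring

lemma Jp_conj {s s' : Equiv.Perm (Fin n)} (h : IsConj s s') : Jp s = Jp s' := by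
  obtain ⟨g, rfl⟩ := isConj_iff.1 h
  apply mul_left_cancel₀ one_sub_X_ne
  rw [Jp_eq, Jp_eq]
  congr 1
  have hg : g⁻¹.permMatrix ℚ[X] * g.permMatrix ℚ[X] = 1 := by
    rw [← permMatrix_mul, mul_inv_cancel, permMatrix_one]
  have e : Mx (g * s * g⁻¹) = g⁻¹.permMatrix ℚ[X] * Mx s * g.permMatrix ℚ[X] := by
    rw [Mx, Mx, permMatrix_mul, permMatrix_mul, Matrix.mul_sub, Matrix.sub_mul, Matrix.mul_one, hg,
      Matrix.mul_smul, Matrix.smul_mul, Matrix.mul_assoc]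
  rw [e, det_mul, det_mul, mul_right_comm, ← det_mul, hg, det_one, one_mul]

lemma block_dvd (s : Equiv.Perm (Fin n)) (p : Fin n → Prop) [DecidablePred p]
    (hp : ∀ i, p i → p (s i)) (hne : ∃ i, p i) :
    (1 - X : ℚ[X]) ∣ (toSquareBlockProp (Mx s) p).det := by
  set N := toSquareBlockProp (Mx s) p with hN
  have h0 : N *ᵥ 1 = (1 - X : ℚ[X]) • (1 : {a // p a} → ℚ[X]) := by
    ext1 i
    simp only [mulVec, dotProduct, Pi.one_apply, mul_one, Pi.smul_apply, smul_eq_mul]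
    have : ∀ j : {a // p a}, N i j = (if i = j then 1 else 0) - (if (⟨s i, hp i i.2⟩ : {a // p a}) = j then X else 0) := by
      intro j
      rw [hN, toSquareBlockProp_def, of_apply, Mx, Matrix.sub_apply, Matrix.smul_apply, perm_apply', one_apply]
      simp [Subtype.ext_iff]
    simp_rw [this]
    rw [Finset.sum_sub_distrib, Finset.sum_ite_eq, Finset.sum_ite_eq]
    simp
  have h1 : N.adjugate *ᵥ (N *ᵥ 1) = N.det • (1 : {a // p a} → ℚ[X]) := by
    rw [mulVec_mulVec, adjugate_mul, smul_mulVec, one_mulVec]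
  rw [h0, mulVec_smul] at h1
  obtain ⟨i, hi⟩ := hne
  have := congrFun h1 ⟨i, hi⟩
  exact ⟨(N.adjugate *ᵥ 1) ⟨i, hi⟩, by simpa using this.symm⟩

lemma Jp_eval_one (s : Equiv.Perm (Fin n)) (x y : Fin n) (h : ¬ s.SameCycle x y) :
    (Jp s).eval 1 = 0 := by
  classical
  have hdet := twoBlockTriangular_det (Mx s) (fun i => ¬ s.SameCycle x i) ?_
  · obtain ⟨q1, h1⟩ := block_dvd s (fun i => ¬ s.SameCycle x i) (fun i hi h' =>
      hi (Equiv.Perm.sameCycle_apply_right.1 h')) ⟨y, h⟩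
    obtain ⟨q2, h2⟩ := block_dvd s (fun i => ¬ ¬ s.SameCycle x i) (fun i hi h' =>
      hi (fun h'' => h' (Equiv.Perm.sameCycle_apply_right.2 h''))) ⟨x, not_not.2 (Equiv.Perm.SameCycle.refl _ _)⟩
    have hJ := Jp_eq s
    rw [hdet, h1, h2] at hJ
    have : Jp s = (n : ℚ[X]) * ((1 - X) * (q1 * q2)) := by
      apply mul_left_cancel₀ one_sub_X_ne
      rw [hJ]; ring
    rw [this]; simp
  · intro i hi j hj
    rw [not_not] at hi
    rw [Mx, Matrix.sub_apply, Matrix.smul_apply, perm_apply', one_apply, if_neg, if_neg]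
    · simp
    · rintro rfl; exact hj (Equiv.Perm.sameCycle_apply_right.2 hi)
    · rintro rfl; exact hj hi

end cutjoin

section walks
open Polynomial
variable {n : ℕ}

lemma W_zero (r : Equiv.Perm (Fin n)) : W 0 r = if r = 1 then 1 else 0 := by
  unfold W Wset
  split_ifs with h
  · subst h
    rw [Set.ncard_eq_one]
    refine ⟨[], ?_⟩
    ext l
    simp only [Set.mem_ofPred_eq, Set.mem_singleton_iff, List.length_eq_zero_iff]
    constructor
    · exact fun h => h.1
    · rintro rfl; simp [prodLR]
  · rw [Set.eq_empty_of_forall_notMem (s := {l : List (Equiv.Perm (Fin n)) | _}), Set.ncard_empty]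
    rintro l ⟨h1, -, h'⟩
    rw [List.length_eq_zero_iff] at h1
    subst h1
    exact h (by rw [← h']; simp [prodLR])

lemma W_succ (m : ℕ) (r : Equiv.Perm (Fin n)) : W (m+1) r = ∑ t ∈ Sw n, W m (r * t) := by
  classical
  have e : Wset (m+1) r = ⋃ t ∈ Sw n, (fun l => t :: l) '' Wset m (r * t) := by
    ext l
    simp only [Set.mem_iUnion, Set.mem_image]
    constructor
    · rintro ⟨h1, h2, h3⟩
      cases l with
      | nil => simp at h1
      | cons t l =>
        have ht := h2 t List.mem_cons_self
        refine ⟨t, mem_Sw.2 ht, l, ⟨by simpa using h1, fun s hs => h2 s (List.mem_cons_of_mem _ hs), ?_⟩, rfl⟩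
        obtain ⟨a, b, hab, rfl⟩ := ht
        rw [← h3, prodLR_cons, mul_assoc, Equiv.swap_mul_self, mul_one]
    · rintro ⟨t, ht, l, ⟨h1, h2, h3⟩, rfl⟩
      have ht := mem_Sw.1 ht
      refine ⟨by simp [h1], ?_, ?_⟩
      · intro s hs
        rcases List.mem_cons.1 hs with rfl | hs
        · exact ht
        · exact h2 s hs
      · obtain ⟨a, b, hab, rfl⟩ := ht
        rw [prodLR_cons, h3, mul_assoc, Equiv.swap_mul_self, mul_one]
  unfold W
  have hinj : ∀ t : Equiv.Perm (Fin n), Function.Injective (fun l => t :: l) := fun t => List.cons_injective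
  have hdis : ((Sw n : Set (Equiv.Perm (Fin n)))).PairwiseDisjoint
      (fun t => (fun l => t :: l) '' Wset m (r * t)) := by
    intro t _ t' _ hne
    rw [Function.onFun, Set.disjoint_left]
    rintro _ ⟨l, _, rfl⟩ ⟨l', _, h⟩
    exact hne (List.cons.inj h).1.symm
  have hU : (⋃ t ∈ Sw n, (fun l => t :: l) '' Wset m (r * t)).Finite := by
    rw [← e]; exact Wset_finite _ _
  rw [e, Set.ncard_eq_toFinset_card _ hU]
  have hfin : ∀ t, ((fun l => t :: l) '' Wset m (r * t)).Finite := fun t => (Wset_finite m (r*t)).image _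
  have : hU.toFinset = (Sw n).biUnion (fun t => (hfin t).toFinset) := by
    ext l; simp
  rw [this, Finset.card_biUnion]
  · refine Finset.sum_congr rfl fun t _ => ?_
    rw [← Set.ncard_eq_toFinset_card _ (hfin t), Set.ncard_image_of_injective _ (hinj t)]
  · intro t ht t' ht' hne
    have := hdis ht ht' hne
    rw [Function.onFun, Finset.disjoint_left]
    intro l hl hl'
    exact (Set.disjoint_left.1 this) ((hfin t).mem_toFinset.1 hl) ((hfin t').mem_toFinset.1 hl')

noncomputable def Tl (n : ℕ) : ℚ[X] →ₗ[ℚ] ℚ[X] :=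
  ((n : ℚ) * (n - 1) / 2) • LinearMap.id - (n : ℚ) • (LinearMap.mulLeft ℚ (X : ℚ[X])).comp derivative

lemma Tl_apply (p : ℚ[X]) : Tl n p = C ((n : ℚ) * (n - 1) / 2) * p - (n : ℚ[X]) * (X * derivative p) := by
  simp [Tl, smul_eq_C_mul]

lemma sum_W_Jp (m : ℕ) : ∑ r : Equiv.Perm (Fin n), (W m r : ℚ) • Jp r = ((Tl n) ^ m) (Jp (1 : Equiv.Perm (Fin n))) := by
  induction m with
  | zero => simp [W_zero]
  | succ m ih =>
    rw [pow_succ', Module.End.mul_apply, ← ih, map_sum]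
    simp_rw [W_succ, Nat.cast_sum, Finset.sum_smul]
    rw [Finset.sum_comm]
    have : ∀ r : Equiv.Perm (Fin n), Tl n ((W m r : ℚ) • Jp r) = ∑ t ∈ Sw n, (W m r : ℚ) • Jp (r * t) := by
      intro r
      rw [map_smul, Tl_apply, ← cutjoin, Finset.smul_sum]
    simp_rw [this]
    rw [Finset.sum_comm (s := Finset.univ) (t := Sw n)]
    refine Finset.sum_congr rfl fun t ht => ?_
    obtain ⟨a, b, hab, rfl⟩ := mem_Sw.1 ht
    refine Fintype.sum_equiv (Equiv.mulRight (Equiv.swap a b)) _ _ fun r => ?_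
    simp [mul_assoc]

lemma Tl_pow_X (m j : ℕ) : ((Tl n) ^ m) ((X : ℚ[X]) ^ j) = ((n : ℚ) * (n - 1) / 2 - n * j) ^ m • X ^ j := by
  induction m with
  | zero => simp
  | succ m ih =>
    rw [pow_succ', Module.End.mul_apply, ih, map_smul, Tl_apply]
    have : (X : ℚ[X]) * derivative (X ^ j) = C (j : ℚ) * X ^ j := by
      cases j with
      | zero => simp
      | succ j => rw [derivative_X_pow]; simp only [Nat.add_sub_cancel]; ring
    rw [this, pow_succ, mul_smul]
    congr 1
    rw [smul_eq_C_mul, C_sub, C_mul (a := (n : ℚ)) (b := (j : ℚ))]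
    simp; ring

noncomputable def Ex : PowerSeries ℚ :=
  PowerSeries.rescale (1/2 : ℚ) (PowerSeries.exp ℚ) - PowerSeries.rescale (-1/2 : ℚ) (PowerSeries.exp ℚ)

lemma rescale_exp_pow (a : ℚ) (k : ℕ) : (PowerSeries.rescale a (PowerSeries.exp ℚ)) ^ k
    = PowerSeries.rescale (k * a) (PowerSeries.exp ℚ) := by
  rw [← map_pow, PowerSeries.exp_pow_eq_rescale_exp, PowerSeries.rescale_rescale, mul_comm]

lemma coeff_Ex_pow (N m : ℕ) : (m.factorial : ℚ) * PowerSeries.coeff m (Ex ^ N)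
    = ∑ j ∈ Finset.range (N+1), (N.choose j : ℚ) * (-1) ^ j * ((N : ℚ) / 2 - j) ^ m := by
  rw [Ex, sub_eq_neg_add, add_pow, map_sum, Finset.mul_sum]
  refine Finset.sum_congr rfl fun j hj => ?_
  have hj : j ≤ N := by simpa [Nat.lt_succ_iff] using hj
  rw [neg_pow, rescale_exp_pow, rescale_exp_pow, mul_assoc ((-1 : PowerSeries ℚ) ^ j),
    PowerSeries.exp_mul_exp_eq_exp_add]
  have e1 : ((-1 : PowerSeries ℚ) ^ j) = PowerSeries.C ((-1 : ℚ) ^ j) := by simp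
  have e2 : ((N.choose j : ℕ) : PowerSeries ℚ) = PowerSeries.C (N.choose j : ℚ) := by simp
  rw [e1, e2, PowerSeries.coeff_mul_C, PowerSeries.coeff_C_mul, PowerSeries.coeff_rescale, PowerSeries.coeff_exp,
    Nat.cast_sub hj]
  have hf : (m.factorial : ℚ) ≠ 0 := by exact_mod_cast m.factorial_ne_zero
  have e3 : ((j : ℚ) * (-1 / 2) + (N - j) * (1 / 2)) = (N : ℚ) / 2 - j := by ring
  rw [e3]
  simp
  field_simp

lemma eval_Tl (hn : 1 ≤ n) (m : ℕ) : (((Tl n) ^ m) (Jp (1 : Equiv.Perm (Fin n)))).eval 1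
    = (n : ℚ) ^ (m + 1) * m.factorial * PowerSeries.coeff m (Ex ^ (n - 1)) := by
  rw [mul_assoc, coeff_Ex_pow, Jp_one hn, sub_eq_neg_add, add_pow]
  have e : (n : ℚ[X]) * ∑ j ∈ Finset.range (n - 1 + 1), (-X) ^ j * 1 ^ (n - 1 - j) * ((n - 1).choose j : ℚ[X])
      = ∑ j ∈ Finset.range (n - 1 + 1), ((n : ℚ) * ((n - 1).choose j * (-1) ^ j)) • (X : ℚ[X]) ^ j := by
    rw [Finset.mul_sum]
    refine Finset.sum_congr rfl fun j _ => ?_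
    rw [neg_pow, smul_eq_C_mul]
    simp; ring
  rw [e, map_sum, eval_finsetSum, Finset.mul_sum]
  refine Finset.sum_congr rfl fun j _ => ?_
  rw [map_smul, Tl_pow_X, eval_smul, eval_smul, eval_pow, eval_X, one_pow]
  have : ((n : ℚ) * (n - 1) / 2 - n * j) = n * (((n - 1 : ℕ) : ℚ) / 2 - j) := by
    rw [Nat.cast_sub hn]; push_cast; ring
  rw [this, mul_pow, pow_succ]
  simp; ring

lemma W_formula (hn : 2 ≤ n) : ∃ K : ℚ, ∀ m, (W m (finRotate n) : ℚ) * K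
    = (n : ℚ) ^ (m + 1) * m.factorial * PowerSeries.coeff m (Ex ^ (n - 1)) := by
  classical
  refine ⟨∑ r ∈ (Finset.univ : Finset (Equiv.Perm (Fin n))).filter (fun r => IsConj (finRotate n) r),
    (Jp r).eval 1, fun m => ?_⟩
  rw [← eval_Tl (by omega), ← sum_W_Jp, eval_finsetSum, Finset.mul_sum, Finset.sum_filter]
  refine Finset.sum_congr rfl fun r _ => ?_
  split_ifs with h
  · rw [W_isConj m h]; simp
  · have : ∃ x y, ¬ r.SameCycle x y := by
      by_contra! h'
      exact h (cyc_eq_one_iff_conj hn r h')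
    obtain ⟨x, y, hxy⟩ := this
    simp [Jp_eval_one r x y hxy]

end walks

section asymp

noncomputable def fs : PowerSeries ℚ := PowerSeries.mk fun i => PowerSeries.coeff (i + 1) Ex

lemma Ex_eq : Ex = PowerSeries.X * fs := by
  ext m
  cases m with
  | zero =>
    rw [PowerSeries.coeff_zero_X_mul, Ex, map_sub, PowerSeries.coeff_rescale, PowerSeries.coeff_rescale]
    simp
  | succ m => rw [PowerSeries.coeff_succ_X_mul, fs, PowerSeries.coeff_mk]

lemma coeff_fs (i : ℕ) : PowerSeries.coeff i fs
    = ((1 / 2) ^ (i + 1) - (-1 / 2) ^ (i + 1)) / ((i + 1).factorial : ℚ) := by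
  rw [fs, PowerSeries.coeff_mk, Ex, map_sub, PowerSeries.coeff_rescale, PowerSeries.coeff_rescale,
    PowerSeries.coeff_exp]
  simp only [Algebra.algebraMap_self, RingHom.id_apply]
  ring

lemma fs_nonneg (i : ℕ) : 0 ≤ PowerSeries.coeff i fs := by
  rw [coeff_fs]
  apply div_nonneg _ (by positivity)
  have : (-1 / 2 : ℚ) ^ (i + 1) ≤ |(-1 / 2 : ℚ) ^ (i + 1)| := le_abs_self _
  rw [abs_pow] at this
  have h : |(-1 / 2 : ℚ)| = 1 / 2 := by norm_num [abs_div]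
  rw [h] at this
  linarith

lemma fs_zero : PowerSeries.coeff 0 fs = 1 := by rw [coeff_fs]; norm_num
lemma fs_two : PowerSeries.coeff 2 fs = 1 / 24 := by
  rw [coeff_fs]; norm_num [Nat.factorial]

lemma fs_pow_nonneg (N i : ℕ) : 0 ≤ PowerSeries.coeff i (fs ^ N) := by
  induction N generalizing i with
  | zero => rw [pow_zero, PowerSeries.coeff_one]; split_ifs <;> norm_num
  | succ N ih =>
    rw [pow_succ, PowerSeries.coeff_mul]
    exact Finset.sum_nonneg fun p _ => mul_nonneg (ih _) (fs_nonneg _)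

lemma fs_pow_zero (N : ℕ) : PowerSeries.coeff 0 (fs ^ N) = 1 := by
  rw [PowerSeries.coeff_zero_eq_constantCoeff_apply, map_pow,
    ← PowerSeries.coeff_zero_eq_constantCoeff_apply, fs_zero, one_pow]

lemma coeff_Ex_pow_lt {N m : ℕ} (h : m < N) : PowerSeries.coeff m (Ex ^ N) = 0 := by
  rw [Ex_eq, mul_pow, PowerSeries.coeff_X_pow_mul', if_neg (by omega)]

lemma coeff_Ex_pow_add (N i : ℕ) : PowerSeries.coeff (N + i) (Ex ^ N) = PowerSeries.coeff i (fs ^ N) := by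
  rw [Ex_eq, mul_pow, PowerSeries.coeff_X_pow_mul', if_pos (by omega), Nat.add_sub_cancel_left]

lemma coeff_X_deriv (f : PowerSeries ℚ) (i : ℕ) :
    PowerSeries.coeff i (PowerSeries.X * PowerSeries.derivative ℚ f) = i * PowerSeries.coeff i f := by
  cases i with
  | zero => simp
  | succ i => rw [PowerSeries.coeff_succ_X_mul, PowerSeries.coeff_derivative]; push_cast; ring

lemma fs_rec (N i : ℕ) : ∑ p ∈ Finset.HasAntidiagonal.antidiagonal i,
    ((N : ℚ) * p.1 - p.2) * (PowerSeries.coeff p.1 fs * PowerSeries.coeff p.2 (fs ^ N)) = 0 := by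
  have h : fs * (PowerSeries.X * PowerSeries.derivative ℚ (fs ^ N))
      = PowerSeries.C (N : ℚ) * ((PowerSeries.X * PowerSeries.derivative ℚ fs) * fs ^ N) := by
    rw [Derivation.leibniz_pow]
    cases N with
    | zero => simp
    | succ N =>
      simp only [Nat.add_sub_cancel, smul_eq_mul, nsmul_eq_mul, map_natCast]
      ring
  have h2 := congrArg (PowerSeries.coeff i) h
  rw [PowerSeries.coeff_C_mul, PowerSeries.coeff_mul, PowerSeries.coeff_mul, Finset.mul_sum,
    ← sub_eq_zero, ← Finset.sum_sub_distrib] at h2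
  rw [← neg_eq_zero, ← h2, ← Finset.sum_neg_distrib]
  refine Finset.sum_congr rfl fun p _ => ?_
  rw [coeff_X_deriv, coeff_X_deriv]
  ring

lemma fs_ineq (N i : ℕ) (hN : i + 2 ≤ N) :
    (N : ℚ) * PowerSeries.coeff i (fs ^ N) ≤ 24 * (i + 2) * PowerSeries.coeff (i + 2) (fs ^ N) := by
  have h := fs_rec N (i + 2)
  rw [Finset.Nat.antidiagonal_succ, Finset.sum_cons, Finset.sum_map] at h
  have h1 : ((N : ℚ) * 2 - i) * (1 / 24 * PowerSeries.coeff i (fs ^ N)) ≤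
     ∑ x ∈ Finset.HasAntidiagonal.antidiagonal (i + 1), ((N : ℚ) * ((x.1 + 1 : ℕ) : ℚ) - x.2)
       * (PowerSeries.coeff (x.1 + 1) fs * PowerSeries.coeff x.2 (fs ^ N)) := by
    have := Finset.single_le_sum (s := Finset.HasAntidiagonal.antidiagonal (i + 1))
      (f := fun x => ((N : ℚ) * ((x.1 + 1 : ℕ) : ℚ) - x.2)
       * (PowerSeries.coeff (x.1 + 1) fs * PowerSeries.coeff x.2 (fs ^ N))) (a := (1, i)) ?_ ?_
    · refine le_trans (le_of_eq ?_) this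
      simp only [Nat.reduceAdd, fs_two]
      norm_num
    · intro x hx
      refine mul_nonneg ?_ (mul_nonneg (fs_nonneg _) (fs_pow_nonneg _ _))
      have hx : x.1 + x.2 = i + 1 := by simpa using hx
      rw [sub_nonneg]
      have : x.2 ≤ N * (x.1 + 1) := by nlinarith
      exact_mod_cast this
    · simp [add_comm]
  have h2 : ((N : ℚ)) * (1 / 24 * PowerSeries.coeff i (fs ^ N)) ≤ ((N : ℚ) * 2 - i) * (1 / 24 * PowerSeries.coeff i (fs ^ N)) := by
    refine mul_le_mul_of_nonneg_right ?_ (mul_nonneg (by norm_num) (fs_pow_nonneg _ _))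
    have : (i : ℚ) + 2 ≤ N := by exact_mod_cast hN
    linarith
  simp only [fs_zero, Function.Embedding.prodMap, Function.Embedding.coeFn_mk, Prod.map,
    Function.Embedding.refl_apply, Nat.succ_eq_add_one] at h
  push_cast at h h1 ⊢
  linarith

lemma fs_pos (N j : ℕ) (hN : 2 * j ≤ N) : 0 < PowerSeries.coeff (2 * j) (fs ^ N) := by
  induction j with
  | zero => simp [fs_pow_zero]
  | succ j ih =>
    have h1 := ih (by omega)
    have h2 := fs_ineq N (2 * j) (by omega)
    have h3 : (0 : ℚ) < N := by exact_mod_cast (by omega : 0 < N)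
    have h4 : 0 < 24 * ((2 * j : ℕ) + 2 : ℚ) * PowerSeries.coeff (2 * j + 2) (fs ^ N) :=
      lt_of_lt_of_le (mul_pos h3 h1) h2
    have := pos_of_mul_pos_right h4 (by positivity)
    exact this

lemma W_ratio (g n : ℕ) (hn : 2 * g + 3 ≤ n) : 0 < W (n - 3 + 2 * g + 2) (finRotate n) ∧
    (n : ℚ) ^ 5 * W (n - 3 + 2 * g) (finRotate n) ≤ 384 * g * W (n - 3 + 2 * g + 2) (finRotate n) := by
  obtain ⟨K, hK⟩ := W_formula (n := n) (by omega)
  obtain ⟨N, rfl⟩ : ∃ N, n = N + 1 := ⟨n - 1, by omega⟩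
  simp only [Nat.add_sub_cancel] at hK
  have e : N + 1 - 3 + 2 * g + 2 = N + 2 * g := by omega
  have hN0 : (2 : ℚ) ≤ N := by exact_mod_cast (by omega : 2 ≤ N)
  have hm := hK (N + 2 * g)
  rw [coeff_Ex_pow_add] at hm
  have hs := fs_pos N g (by omega)
  have hpos : 0 < (W (N + 2 * g) (finRotate (N + 1)) : ℚ) * K := by rw [hm]; positivity
  have hK0 : 0 < K := by
    by_contra! h
    exact absurd hpos (not_lt.2 (mul_nonpos_of_nonneg_of_nonpos (by positivity) h))
  have hW : 0 < (W (N + 2 * g) (finRotate (N + 1)) : ℚ) := (pos_iff_pos_of_mul_pos hpos).2 hK0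
  rw [e]
  refine ⟨by exact_mod_cast hW, ?_⟩
  have hm' := hK (N + 1 - 3 + 2 * g)
  cases g with
  | zero =>
    rw [coeff_Ex_pow_lt (by omega), mul_zero ((_ : ℚ) * _)] at hm'
    have : (W (N + 1 - 3 + 2 * 0) (finRotate (N + 1)) : ℚ) = 0 := by
      rcases mul_eq_zero.1 hm' with h | h
      · exact h
      · exact absurd h hK0.ne'
    rw [this]; simp
  | succ g =>
    have e2 : N + 1 - 3 + 2 * (g + 1) = N + 2 * g := by omega
    rw [e2] at hm' ⊢
    rw [coeff_Ex_pow_add] at hm'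
    have e3 : N + 2 * (g + 1) = N + 2 * g + 2 := by omega
    have hi := fs_ineq N (2 * g) (by omega)
    rw [e3, show 2 * (g + 1) = 2 * g + 2 by ring, Nat.factorial_succ, Nat.factorial_succ] at hm
    rw [e3]
    set w := (W (N + 2 * g) (finRotate (N + 1)) : ℚ)
    set v := (W (N + 2 * g + 2) (finRotate (N + 1)) : ℚ)
    set s := PowerSeries.coeff (2 * g) (fs ^ N)
    set s' := PowerSeries.coeff (2 * g + 2) (fs ^ N)
    have hs0 : 0 < s := fs_pos N g (by omega)
    push_cast at hm hm' hi ⊢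
    set Q := ((N : ℚ) + 1) ^ (N + 2 * g + 1) * ((N + 2 * g).factorial : ℚ) with hQ
    have hQ0 : 0 < Q := by positivity
    have hmm : v * K = ((N : ℚ) + 1) ^ 2 * ((N + 2 * g + 1 + 1) * (N + 2 * g + 1)) * Q * s' := by
      rw [hm, hQ]; ring
    -- multiply the claim by K
    refine le_of_mul_le_mul_right ?_ hK0
    have e5 : ((N : ℚ) + 1) ^ 5 * w * K = ((N : ℚ) + 1) ^ 5 * Q * s := by rw [mul_assoc, hm']; ring
    have e6 : 384 * ((g : ℚ) + 1) * v * K = 384 * ((g : ℚ) + 1) * (((N : ℚ) + 1) ^ 2 * ((N + 2 * g + 1 + 1) * (N + 2 * g + 1)) * Q * s') := by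
      rw [mul_assoc, hmm]
    rw [e5, e6]
    have hg0 : (0 : ℚ) ≤ g := by positivity
    have a1 : ((N : ℚ) + 1) ^ 3 * s ≤ 384 * ((g : ℚ) + 1) * ((N + 1) * (N + 1)) * s' := by
      have : ((N : ℚ) + 1) * s ≤ 2 * (N * s) := by nlinarith
      have b : ((N : ℚ) + 1) * s ≤ 384 * ((g : ℚ) + 1) * s' := by
        have : 0 < ((g : ℚ) + 1) * s' := by
          have := fs_pos N (g + 1) (by omega)
          exact mul_pos (by positivity) this
        nlinarith
      have := mul_le_mul_of_nonneg_left b (by positivity : 0 ≤ ((N : ℚ) + 1) ^ 2)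
      nlinarith
    have hs' : 0 < s' := fs_pos N (g + 1) (by omega)
    have a2 : ((N : ℚ) + 1) * (N + 1) ≤ (N + 2 * g + 1 + 1) * (N + 2 * g + 1) := by nlinarith
    calc ((N : ℚ) + 1) ^ 5 * Q * s = ((N : ℚ) + 1) ^ 2 * Q * (((N : ℚ) + 1) ^ 3 * s) := by ring
      _ ≤ ((N : ℚ) + 1) ^ 2 * Q * (384 * ((g : ℚ) + 1) * ((N + 1) * (N + 1)) * s') := by gcongr
      _ ≤ ((N : ℚ) + 1) ^ 2 * Q * (384 * ((g : ℚ) + 1) * ((N + 2 * g + 1 + 1) * (N + 2 * g + 1)) * s') := by gcongr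
      _ = _ := by ring

end asymp

theorem stmt13 (g : ℕ) (k : ℕ → ℕ)
    (hk : Tendsto (fun n => (k n : ℝ) / Real.sqrt n) atTop (nhds 0)) :
    Tendsto (fun n =>
        (Set.ncard {F | F ∈ Fcal n g ∧ genus n (F.take (k n)) = 0} : ℝ) /
          (Set.ncard (Fcal n g) : ℝ))
      atTop (nhds 1) := by
  have key : ∀ n, 2 * g + 3 ≤ n →
      1 - 384 * g * ((k n : ℝ) / Real.sqrt n) ^ 2 ≤
        (Set.ncard {F | F ∈ Fcal n g ∧ genus n (F.take (k n)) = 0} : ℝ) / (Set.ncard (Fcal n g) : ℝ) ∧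
      (Set.ncard {F | F ∈ Fcal n g ∧ genus n (F.take (k n)) = 0} : ℝ) / (Set.ncard (Fcal n g) : ℝ) ≤ 1 := by
    intro n hn
    obtain ⟨h1, h2⟩ := W_ratio g n hn
    have hF : Fcal n g = Wset (n - 3 + 2 * g + 2) (finRotate n) := by
      have : n - 3 + 2 * g + 2 = n - 1 + 2 * g := by omega
      rw [this]; rfl
    rw [hF]
    have hb := bad_count (n := n) (by omega) (n - 3 + 2 * g) (k n)
    have hsum := Set.ncard_inter_add_ncard_sdiff_eq_ncard (Wset (n - 3 + 2 * g + 2) (finRotate n))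
      {F | genus n (F.take (k n)) = 0} (Wset_finite _ _)
    change Set.ncard {F | F ∈ Wset (n - 3 + 2 * g + 2) (finRotate n) ∧ genus n (F.take (k n)) = 0} +
      Set.ncard {F | F ∈ Wset (n - 3 + 2 * g + 2) (finRotate n) ∧ genus n (F.take (k n)) ≠ 0}
        = W (n - 3 + 2 * g + 2) (finRotate n) at hsum
    change _ ≤ _ / ((W (n - 3 + 2 * g + 2) (finRotate n) : ℕ) : ℝ) ∧ _ / ((W (n - 3 + 2 * g + 2) (finRotate n) : ℕ) : ℝ) ≤ _
    generalize Set.ncard {F | F ∈ Wset (n - 3 + 2 * g + 2) (finRotate n) ∧ genus n (F.take (k n)) = 0} = A at *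
    generalize Set.ncard {F | F ∈ Wset (n - 3 + 2 * g + 2) (finRotate n) ∧ genus n (F.take (k n)) ≠ 0} = B at *
    generalize W (n - 3 + 2 * g + 2) (finRotate n) = V at *
    generalize W (n - 3 + 2 * g) (finRotate n) = U at *
    have hV : (0 : ℝ) < V := by exact_mod_cast h1
    have hn0 : (0 : ℝ) < n := by exact_mod_cast (by omega : 0 < n)
    have hs : (A : ℝ) + B = V := by exact_mod_cast hsum
    have hb' : (B : ℝ) ≤ (k n : ℝ) ^ 2 * ((n : ℝ) ^ 4 * U) := by exact_mod_cast hb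
    have h2' : (n : ℝ) ^ 5 * U ≤ 384 * g * V := by exact_mod_cast h2
    have hB : (0 : ℝ) ≤ B := by positivity
    constructor
    · rw [le_div_iff₀ hV, div_pow, Real.sq_sqrt hn0.le]
      have : (B : ℝ) ≤ 384 * g * ((k n : ℝ) ^ 2 / n) * V := by
        refine hb'.trans ?_
        have : 384 * (g : ℝ) * ((k n : ℝ) ^ 2 / n) * V = (k n : ℝ) ^ 2 * ((384 * g * V) / n) := by
          field_simp
        rw [this]
        refine mul_le_mul_of_nonneg_left ?_ (by positivity)
        rw [le_div_iff₀ hn0]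
        linarith
      linarith
    · rw [div_le_one hV]; linarith
  have hlim : Tendsto (fun n => 1 - 384 * (g : ℝ) * ((k n : ℝ) / Real.sqrt n) ^ 2) atTop (nhds 1) := by
    have := ((hk.pow 2).const_mul (384 * (g : ℝ))).const_sub 1
    simpa using this
  refine tendsto_of_tendsto_of_tendsto_of_le_of_le' hlim tendsto_const_nhds ?_ ?_
  · filter_upwards [eventually_ge_atTop (2 * g + 3)] with n hn using (key n hn).1
  · filter_upwards [eventually_ge_atTop (2 * g + 3)] with n hn using (key n hn).2
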